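/- Let T = (a, a', a'', e, e', e'') be a potential blocking tuple for a matching μ in the affiliate matching problem in which e' and a'' are dummies, and let μ* be the swapped matching of μ with respect to T. Suppose 0 < λ ≤ 1, a' ∈ aff(e), a ∉ aff(e), pr_e^e(a') = 1, pr_e^{a'}(e) = 0, and it is not the case that both pr_e^e(a) = 1 and pr_e^{a'}(e'') = 1 (with pr_e^{a'}(e'') taken as 0 when e'' is a dummy). Then val_e(μ*) ≤ val_e(μ); in particular, e does not strictly prefer μ* to μ. -/

import Mathlib

open Finset

/-- The set of employers matched to applicant `a` in the matching `μ` (viewed as a set of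
applicant–employer pairs). -/
def matchedE {A E : Type*} [DecidableEq A] [DecidableEq E] (μ : Finset (A × E)) (a : A) :
    Finset E :=
  (μ.filter fun p => p.1 = a).image Prod.snd

/-- The set of applicants matched to employer `e` in the matching `μ`. -/
def matchedA {A E : Type*} [DecidableEq A] [DecidableEq E] (μ : Finset (A × E)) (e : E) :
    Finset A :=
  (μ.filter fun p => p.2 = e).image Prod.fst

/-- The valuation of applicant `a` for the matching `μ`:  `val_a(μ) = ∑_{e ∈ μ(a)} pr_a(e)`. -/
def valA {A E : Type*} [DecidableEq A] [DecidableEq E] (prA : A → E → ℝ)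
    (μ : Finset (A × E)) (a : A) : ℝ :=
  ∑ x ∈ matchedE μ a, prA a x

/-- The valuation of employer `e` for the matching `μ`:
`val_e(μ) = ∑_{a ∈ μ(e)} pr_e^e(a) + λ ∑_{a ∈ aff(e)} ∑_{e* ∈ μ(a)} pr_e^a(e*)`. -/
def valE {A E : Type*} [DecidableEq A] [DecidableEq E] (aff : E → Finset A) (lam : ℝ)
    (prEE : E → A → ℝ) (prEA : E → A → E → ℝ) (μ : Finset (A × E)) (e : E) : ℝ :=
  ∑ b ∈ matchedA μ e, prEE e b + lam * ∑ b ∈ aff e, ∑ x ∈ matchedE μ b, prEA e b x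

/-- `μ` is a matching respecting the capacity quotas `qA` (applicants) and `qE` (employers). -/
def IsMatching {A E : Type*} [DecidableEq A] [DecidableEq E] (qA : A → ℕ) (qE : E → ℕ)
    (μ : Finset (A × E)) : Prop :=
  (∀ a, (matchedE μ a).card ≤ qA a) ∧ ∀ e, (matchedA μ e).card ≤ qE e

/-- The pair `(a, e)` as a (possibly empty) finite set, where `a` and `e` may be dummies. -/
def optPair {A E : Type*} : Option A → Option E → Finset (A × E)
  | some a, some e => {(a, e)}
  | _, _ => ∅

/-- The swapped matching of `μ` with respect to the tuple `(a, a', a'', e, e', e'')`: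
add the pair `(a, e)`, remove the pairs `(a, e')` and `(a', e)` when the corresponding entries
are non-dummy, and add the pairs `(a'', e')` and `(a', e'')` when the corresponding entries are
non-dummy. -/
def swapped {A E : Type*} [DecidableEq A] [DecidableEq E] (μ : Finset (A × E)) (a : A)
    (a' a'' : Option A) (e : E) (e' e'' : Option E) : Finset (A × E) :=
  ((μ \ (optPair (some a) e' ∪ optPair a' (some e))) ∪ {(a, e)})
    ∪ optPair a'' e' ∪ optPair a' e''

/-- `(a, a', a'', e, e', e'')` is a potential blocking tuple for `μ`:  `e ∉ μ(a)`,
`e'` is an element of `μ(a)` or a dummy, `a'` is an element of `μ(e)` or a dummy, and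
`a''` and `e''` are an applicant other than `a` and an employer other than `e`, or dummies. -/
def IsPotentialBlockingTuple {A E : Type*} [DecidableEq A] [DecidableEq E]
    (μ : Finset (A × E)) (a : A) (a' a'' : Option A) (e : E) (e' e'' : Option E) : Prop :=
  (a, e) ∉ μ ∧ (∀ x, e' = some x → (a, x) ∈ μ) ∧ (∀ b, a' = some b → (b, e) ∈ μ) ∧
    a'' ≠ some a ∧ e'' ≠ some e

/-- `pr_e^e(·)` extended to a possibly-dummy applicant argument (dummy values are `0`). -/
def prEEo {A E : Type*} (prEE : E → A → ℝ) (e : E) : Option A → ℝ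
  | some b => prEE e b
  | none => 0

/-- `pr_e^{·}(·)` extended to possibly-dummy arguments (dummy values are `0`). -/
def prEAo {A E : Type*} (prEA : E → A → E → ℝ) (e : E) : Option A → Option E → ℝ
  | some b, some x => prEA e b x
  | _, _ => 0

/-- The indicator that a possibly-dummy applicant belongs to `aff(e)`. -/
def affInd {A E : Type*} [DecidableEq A] (aff : E → Finset A) (e : E) : Option A → ℝ
  | some b => if b ∈ aff e then 1 else 0
  | none => 0

theorem mem_matchedE {A E : Type*} [DecidableEq A] [DecidableEq E] {μ : Finset (A × E)}
    {a : A} {x : E} : x ∈ matchedE μ a ↔ (a, x) ∈ μ := by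
  simp [matchedE]

theorem mem_matchedA {A E : Type*} [DecidableEq A] [DecidableEq E] {μ : Finset (A × E)}
    {e : E} {c : A} : c ∈ matchedA μ e ↔ (c, e) ∈ μ := by
  simp [matchedA]

theorem mem_swapped_none_none {A E : Type*} [DecidableEq A] [DecidableEq E]
    {μ : Finset (A × E)} {a b c : A} {e x : E} {e'' : Option E} :
    (c, x) ∈ swapped μ a (some b) none e none e'' ↔
      ((c, x) ∈ μ ∧ ¬ (c = b ∧ x = e)) ∨ (c = a ∧ x = e) ∨ (c = b ∧ e'' = some x) := by
  cases e'' <;> simp [swapped, optPair, eq_comm] <;> tauto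

/-- The partners of `e` after the swap: `b` is replaced by `a`. -/
theorem matchedA_swapped_none_none {A E : Type*} [DecidableEq A] [DecidableEq E]
    (μ : Finset (A × E)) (a b : A) (e : E) {e'' : Option E} (he : e'' ≠ some e) :
    matchedA (swapped μ a (some b) none e none e'') e = insert a ((matchedA μ e).erase b) := by
  ext c
  simp only [mem_matchedA, mem_swapped_none_none, mem_insert, mem_erase]
  tauto

/-- Applicants other than `a` and `b` keep their partners. -/
theorem matchedE_swapped_none_none_of_ne {A E : Type*} [DecidableEq A] [DecidableEq E]
    (μ : Finset (A × E)) {a b c : A} (e : E) (e'' : Option E) (hca : c ≠ a) (hcb : c ≠ b) :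
    matchedE (swapped μ a (some b) none e none e'') c = matchedE μ c := by
  ext x
  simp only [mem_matchedE, mem_swapped_none_none]
  tauto

/-- The value that `e` derives from the partners of the released affiliate `b` grows by at most
the value of the new partner of `b`. -/
theorem sum_matchedE_swapped_none_none_le {A E : Type*} [DecidableEq A] [DecidableEq E]
    {prEA : E → A → E → ℝ} (μ : Finset (A × E)) {a b : A} (e : E) (e'' : Option E)
    (hnonneg : ∀ x, 0 ≤ prEA e b x) (hba : b ≠ a) :
    ∑ x ∈ matchedE (swapped μ a (some b) none e none e'') b, prEA e b x ≤
      ∑ x ∈ matchedE μ b, prEA e b x + prEAo prEA e (some b) e'' := by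
  cases e'' with
  | none =>
    simp only [prEAo, add_zero]
    refine sum_le_sum_of_subset_of_nonneg (fun x hx => ?_) fun x _ _ => hnonneg x
    simp only [mem_matchedE, mem_swapped_none_none] at hx ⊢
    simp_all
  | some y =>
    have hsub : matchedE (swapped μ a (some b) none e none (some y)) b ⊆
        insert y (matchedE μ b) := fun x hx => by
      simp only [mem_matchedE, mem_swapped_none_none, mem_insert, Option.some.injEq] at hx ⊢
      rcases hx with h | h | h
      · exact Or.inr h.1
      · exact absurd h.1 hba
      · exact Or.inl h.2.symm
    refine (sum_le_sum_of_subset_of_nonneg hsub fun x _ _ => hnonneg x).trans ?_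
    by_cases hy : y ∈ matchedE μ b
    · rw [insert_eq_of_mem hy]
      exact le_add_of_nonneg_right (hnonneg y)
    · rw [sum_insert hy, add_comm]
      exact le_rfl

/-- Let `T = (a, a', a'', e, e', e'')` be a potential blocking tuple for `μ` in
which `e'` and `a''` are dummies, and `μ*` the swapped matching of `μ` w.r.t. `T`.  Suppose
`0 < λ ≤ 1`, `a' ∈ aff(e)` (with `a' = some b` non-dummy), `a ∉ aff(e)`, `pr_e^e(a') = 1`,
`pr_e^{a'}(e) = 0`, and it is not the case that both `pr_e^e(a) = 1` and `pr_e^{a'}(e'') = 1`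
(with `pr_e^{a'}(e'')` taken as `0` when `e''` is a dummy).  Then `val_e(μ*) ≤ val_e(μ)`; in
particular `e` does not strictly prefer `μ*` to `μ`. -/
theorem swap_case_affiliate_liked_by_employer {A E : Type*} [DecidableEq A] [DecidableEq E]
    (aff : E → Finset A) (lam : ℝ) (hlam : 0 < lam) (hlam1 : lam ≤ 1)
    (prA : A → E → ℝ) (prEE : E → A → ℝ) (prEA : E → A → E → ℝ)
    (hprA : ∀ a e, prA a e = 0 ∨ prA a e = 1)
    (hprEE : ∀ e b, prEE e b = 0 ∨ prEE e b = 1)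
    (hprEA : ∀ e b x, prEA e b x = 0 ∨ prEA e b x = 1)
    (qA : A → ℕ) (qE : E → ℕ) (μ : Finset (A × E)) (hμ : IsMatching qA qE μ)
    (a : A) (a' : Option A) (e : E) (e'' : Option E)
    (hT : IsPotentialBlockingTuple μ a a' (none : Option A) e (none : Option E) e'')
    (b : A) (hb : a' = some b)
    (hbaff : b ∈ aff e) (haff : a ∉ aff e)
    (hb1 : prEE e b = 1) (hb2 : prEA e b e = 0)
    (hnot : ¬ (prEE e a = 1 ∧ prEAo prEA e a' e'' = 1)) :
    valE aff lam prEE prEA (swapped μ a a' none e none e'') e ≤ valE aff lam prEE prEA μ e ∧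
      ¬ valE aff lam prEE prEA μ e <
          valE aff lam prEE prEA (swapped μ a a' none e none e'') e := by
  subst hb
  obtain ⟨hae, -, hbe, -, he⟩ := hT
  have hbμ : (b, e) ∈ μ := hbe b rfl
  have hba : b ≠ a := by
    rintro rfl
    exact hae hbμ
  have hnonneg : ∀ x, 0 ≤ prEA e b x := fun x => by
    rcases hprEA e b x with h | h <;> simp [h]
  have hdirect : ∑ c ∈ matchedA (swapped μ a (some b) none e none e'') e, prEE e c =
      ∑ c ∈ matchedA μ e, prEE e c + prEE e a - 1 := by
    have haA : a ∉ (matchedA μ e).erase b := fun h =>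
      hae (mem_matchedA.1 (mem_of_mem_erase h))
    rw [matchedA_swapped_none_none μ a b e he, sum_insert haA,
      ← add_sum_erase _ _ (mem_matchedA.2 hbμ), hb1]
    ring
  have haffil : ∑ c ∈ aff e, ∑ x ∈ matchedE (swapped μ a (some b) none e none e'') c,
        prEA e c x ≤
      ∑ c ∈ aff e, ∑ x ∈ matchedE μ c, prEA e c x + prEAo prEA e (some b) e'' := by
    have hrest : ∑ c ∈ (aff e).erase b,
          ∑ x ∈ matchedE (swapped μ a (some b) none e none e'') c, prEA e c x =
        ∑ c ∈ (aff e).erase b, ∑ x ∈ matchedE μ c, prEA e c x :=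
      sum_congr rfl fun c hc => by
        have hca : c ≠ a := by
          rintro rfl
          exact haff (mem_of_mem_erase hc)
        rw [matchedE_swapped_none_none_of_ne μ e e'' hca (ne_of_mem_erase hc)]
    rw [← add_sum_erase _ _ hbaff, ← add_sum_erase _ _ hbaff, hrest]
    linarith [sum_matchedE_swapped_none_none_le μ e e'' hnonneg hba]
  have hgain : prEE e a + lam * prEAo prEA e (some b) e'' ≤ 1 := by
    have hp : prEAo prEA e (some b) e'' = 0 ∨ prEAo prEA e (some b) e'' = 1 := by
      cases e'' with
      | none => exact Or.inl rfl
      | some y => exact hprEA e b y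
    rcases hprEE e a with h | h <;> rcases hp with h' | h'
    · simp [h, h']
    · simpa [h, h'] using hlam1
    · simp [h, h']
    · exact absurd ⟨h, h'⟩ hnot
  have hle : valE aff lam prEE prEA (swapped μ a (some b) none e none e'') e ≤
      valE aff lam prEE prEA μ e := by
    unfold valE
    rw [hdirect]
    linarith [mul_le_mul_of_nonneg_left haffil hlam.le]
  exact ⟨hle, hle.not_gt⟩
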